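/- For the fully discrete polygonal mean curvature flow, i.e., the fully discrete polygonal evolution law with Ḡ_i = 0 for all i and edge velocities v̄_i = −κ̄_i, the change of length satisfies (L − L̂)/Δt = −Σ_{i=1}^N κ̄_i² r̄_i ≤ 0; in particular L ≤ L̂, so the length is nonincreasing independently of the time step size Δt. -/

import Mathlib

open Real

/-- Euclidean norm on the plane `ℝ × ℝ`. -/
noncomputable def norm2 (p : ℝ × ℝ) : ℝ := Real.sqrt (p.1 ^ 2 + p.2 ^ 2)

/-- Rotation by `π/2`: `J(a,b) = (-b,a)`. -/
def Jrot (p : ℝ × ℝ) : ℝ × ℝ := (-p.2, p.1)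

/-- Euclidean dot product on the plane `ℝ × ℝ`. -/
def dot (p q : ℝ × ℝ) : ℝ := p.1 * q.1 + p.2 * q.2

lemma norm2_sq (p : ℝ × ℝ) : norm2 p ^ 2 = p.1 ^ 2 + p.2 ^ 2 :=
  Real.sq_sqrt (by positivity)

lemma norm2_nonneg (p : ℝ × ℝ) : 0 ≤ norm2 p := Real.sqrt_nonneg _

lemma norm2_pos {p : ℝ × ℝ} (hp : p ≠ 0) : 0 < norm2 p := by
  refine (norm2_nonneg p).lt_of_ne' fun h => hp ?_
  have hsq := norm2_sq p
  rw [h] at hsq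
  ext
  · exact pow_eq_zero_iff two_ne_zero |>.mp (by nlinarith [sq_nonneg p.1, sq_nonneg p.2])
  · exact pow_eq_zero_iff two_ne_zero |>.mp (by nlinarith [sq_nonneg p.1, sq_nonneg p.2])

/-- The difference of two lengths, as a dot product with the averaged direction. -/
lemma norm2_sub_norm2 {p q : ℝ × ℝ} (h : norm2 p + norm2 q ≠ 0) :
    norm2 p - norm2 q = dot ((norm2 p + norm2 q)⁻¹ • (p + q)) (p - q) := by
  have hp := norm2_sq p
  have hq := norm2_sq q
  simp only [dot, Prod.smul_fst, Prod.smul_snd, Prod.fst_add, Prod.snd_add, Prod.fst_sub,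
    Prod.snd_sub, smul_eq_mul]
  field_simp
  linear_combination hp - hq

/-- Summation by parts on a cyclic index set. -/
lemma sum_dot_sub_shift {N : ℕ} [NeZero N] (D Y : ZMod N → ℝ × ℝ) :
    ∑ i, dot (D i) (Y i - Y (i - 1)) = -∑ i, dot (D (i + 1) - D i) (Y i) := by
  have hshift : ∑ i, dot (D i) (Y (i - 1)) = ∑ i, dot (D (i + 1)) (Y i) := by
    rw [← Equiv.sum_comp (Equiv.addRight (1 : ZMod N)) fun i => dot (D i) (Y (i - 1))]
    simp
  have hleft : ∀ i, dot (D i) (Y i - Y (i - 1)) = dot (D i) (Y i) - dot (D i) (Y (i - 1)) := by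
    intro i
    simp only [dot, Prod.fst_sub, Prod.snd_sub]
    ring
  have hright : ∀ i, dot (D (i + 1) - D i) (Y i) = dot (D (i + 1)) (Y i) - dot (D i) (Y i) := by
    intro i
    simp only [dot, Prod.fst_sub, Prod.snd_sub]
    ring
  simp only [hleft, hright, Finset.sum_sub_distrib, hshift]
  ring

/-- The averaging from edges to vertices and the one from vertices to edges are adjoint. -/
lemma sum_mul_edge_average {N : ℕ} [NeZero N] (F α β v : ZMod N → ℝ) :
    ∑ i, F i * (α i * v i + β i * v (i + 1)) =
      ∑ i, (F i * α i + F (i - 1) * β (i - 1)) * v i := by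
  have hshift : ∑ i, F (i - 1) * β (i - 1) * v i = ∑ i, F i * β i * v (i + 1) := by
    rw [← Equiv.sum_comp (Equiv.addRight (1 : ZMod N)) fun i => F (i - 1) * β (i - 1) * v i]
    simp
  simp only [mul_add, add_mul, Finset.sum_add_distrib, hshift, ← mul_assoc]

/-- The dot product of a multiple of a unit vector `n` with a vector given in the frame
`(n, Jrot n)`. -/
lemma dot_smul_frame {n : ℝ × ℝ} (hn : norm2 n = 1) (f v w : ℝ) :
    dot (f • n) (v • n + w • Jrot n) = f * v := by
  have hsq := norm2_sq n
  rw [hn] at hsq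
  simp only [dot, Jrot, Prod.smul_fst, Prod.smul_snd, Prod.fst_add, Prod.snd_add, smul_eq_mul]
  linear_combination (-(f * v)) * hsq

/-- Fully discrete polygonal mean curvature flow (`v̄ᵢ = −κ̄ᵢ`, `Ḡᵢ = 0`):
`(L − L̂)/Δt = −Σ κ̄ᵢ² r̄ᵢ ≤ 0`; in particular `L ≤ L̂` independently of `Δt`. -/
theorem fully_discrete_mcf_curve_shortening
    (N : ℕ) [NeZero N] (hN : 3 ≤ N)
    (X Xh : ZMod N → ℝ × ℝ)
    (hX : ∀ i, X i ≠ X (i - 1)) (hXh : ∀ i, Xh i ≠ Xh (i - 1))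
    (r rh : ZMod N → ℝ)
    (hr : ∀ i, r i = norm2 (X i - X (i - 1)))
    (hrh : ∀ i, rh i = norm2 (Xh i - Xh (i - 1)))
    (Xb : ZMod N → ℝ × ℝ)
    (hXb : ∀ i, Xb i = (1 / 2 : ℝ) • (X i + Xh i))
    (D : ZMod N → ℝ × ℝ)
    (hD : ∀ i, D i = (2 / (r i + rh i)) • (Xb i - Xb (i - 1)))
    (Δt : ℝ) (hΔt : 0 < Δt)
    (Nb Tb : ZMod N → ℝ × ℝ)
    (hNb : ∀ i, norm2 (Nb i) = 1)
    (hTb : ∀ i, Tb i = Jrot (Nb i))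
    (Fb Gb : ZMod N → ℝ)
    (hFG : ∀ i, D (i + 1) - D i = Fb i • Nb i + Gb i • Tb i)
    (Vb Wb : ZMod N → ℝ)
    (hevol : ∀ i, Δt⁻¹ • (X i - Xh i) = Vb i • Nb i + Wb i • Tb i)
    (rb : ZMod N → ℝ)
    (hrb : ∀ i, rb i = norm2 (Xb i - Xb (i - 1)))
    (hrbne : ∀ i, rb i ≠ 0)
    (α β : ZMod N → ℝ)
    (hα : ∀ i, α i = rb i / (rb i + rb (i + 1)))
    (hβ : ∀ i, β i = rb (i + 1) / (rb i + rb (i + 1)))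
    (vb : ZMod N → ℝ)
    (hVb : ∀ i, Vb i = α i * vb i + β i * vb (i + 1))
    (κb : ZMod N → ℝ)
    (hκb : ∀ i, κb i = -(Fb i * α i + Fb (i - 1) * β (i - 1)) / rb i)
    (hG : ∀ i, Gb i = 0)
    (hv : ∀ i, vb i = -κb i) :
    ((∑ i, r i) - ∑ i, rh i) / Δt = -(∑ i, (κb i) ^ 2 * rb i)
    ∧ -(∑ i, (κb i) ^ 2 * rb i) ≤ 0
    ∧ (∑ i, r i) ≤ ∑ i, rh i := by
  have hedge : ∀ i, r i - rh i = dot (D i) ((X i - Xh i) - (X (i - 1) - Xh (i - 1))) := by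
    intro i
    have hpos : norm2 (X i - X (i - 1)) + norm2 (Xh i - Xh (i - 1)) ≠ 0 :=
      (add_pos (norm2_pos (sub_ne_zero.mpr (hX i))) (norm2_pos (sub_ne_zero.mpr (hXh i)))).ne'
    rw [hD, hr, hrh, norm2_sub_norm2 hpos, hXb, hXb]
    congr 1
    · rw [← smul_sub, smul_smul]
      congr 1
      · ring
      · abel
    · abel
  have hvertex : ∀ i, dot (D (i + 1) - D i) (X i - Xh i) = Δt * (Fb i * Vb i) := by
    intro i
    have hY : X i - Xh i = Δt • (Vb i • Nb i + Wb i • Tb i) := by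
      rw [← hevol, smul_inv_smul₀ hΔt.ne']
    rw [← dot_smul_frame (hNb i) (Fb i) (Vb i) (Wb i), hFG, hG, hY, hTb]
    simp only [dot, zero_smul, add_zero, Prod.smul_fst, Prod.smul_snd, smul_eq_mul]
    ring
  have hcurv : ∀ i, (Fb i * α i + Fb (i - 1) * β (i - 1)) * vb i = κb i ^ 2 * rb i := by
    intro i
    have h : κb i * rb i = -(Fb i * α i + Fb (i - 1) * β (i - 1)) := by
      rw [hκb, div_mul_cancel₀ _ (hrbne i)]
    rw [hv]
    linear_combination (-κb i) * h
  have hlength : (∑ i, r i) - ∑ i, rh i = Δt * -(∑ i, κb i ^ 2 * rb i) := by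
    rw [← Finset.sum_sub_distrib, Finset.sum_congr rfl fun i _ => hedge i,
      sum_dot_sub_shift D fun i => X i - Xh i, Finset.sum_congr rfl fun i _ => hvertex i,
      ← Finset.mul_sum, mul_neg]
    simp only [hVb, sum_mul_edge_average, hcurv]
  have hnonpos : -(∑ i, κb i ^ 2 * rb i) ≤ 0 :=
    neg_nonpos.mpr <| Finset.sum_nonneg fun i _ =>
      mul_nonneg (sq_nonneg _) (hrb i ▸ norm2_nonneg _)
  refine ⟨?_, hnonpos, ?_⟩
  · rw [hlength, mul_div_cancel_left₀ _ hΔt.ne']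
  · exact sub_nonpos.mp (hlength ▸ mul_nonpos_of_nonneg_of_nonpos hΔt.le hnonpos)
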